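/- Let c > 0, let ⊕ be a binary operation on [0,c) with identity element 0, and suppose there is a continuous strictly decreasing function f mapping [0,c) onto (0,1] with f(v ⊕ w) = f(v)·f(w) for all v, w ∈ [0,c). Then there exist a continuous strictly increasing bijection u : [0,c) → [0,c) and a constant ξ > 0 such that f(v) = ((c - u(v))/(c + u(v)))^ξ for all v ∈ [0,c). -/

import Mathlib

/-- The Möbius map `y ↦ c (1 - y) / (1 + y)` sends `(0, 1]` onto `[0, c)`. -/
lemma image_mobius_Ioc {c : ℝ} (hc : 0 < c) :
    (fun y : ℝ => c * (1 - y) / (1 + y)) '' Set.Ioc 0 1 = Set.Ico 0 c := by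
  ext z
  constructor
  · rintro ⟨y, ⟨hy0, hy1⟩, rfl⟩
    refine ⟨div_nonneg (mul_nonneg hc.le (by linarith)) (by linarith), ?_⟩
    rw [div_lt_iff₀ (by linarith)]
    nlinarith [mul_pos hc hy0]
  · rintro ⟨hz0, hzc⟩
    have hcz : 0 < c + z := by linarith
    refine ⟨(c - z) / (c + z), ⟨div_pos (by linarith) hcz, ?_⟩, ?_⟩
    · rw [div_le_one hcz]
      linarith
    · have hne : c + z ≠ 0 := hcz.ne'
      have h1 : 1 - (c - z) / (c + z) = 2 * z / (c + z) := by field_simp; ring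
      have h2 : 1 + (c - z) / (c + z) = 2 * c / (c + z) := by field_simp; ring
      simp only [h1, h2]
      field_simp

/-- The Möbius map `y ↦ c (1 - y) / (1 + y)` is strictly decreasing on `(0, 1]`. -/
lemma strictAntiOn_mobius {c : ℝ} (hc : 0 < c) :
    StrictAntiOn (fun y : ℝ => c * (1 - y) / (1 + y)) (Set.Ioc 0 1) := by
  rintro x ⟨hx, -⟩ y ⟨hy, -⟩ hxy
  simp only
  rw [div_lt_div_iff₀ (by linarith) (by linarith)]
  nlinarith [mul_lt_mul_of_pos_left hxy hc]

theorem stmt_4 (c : ℝ) (hc : 0 < c) (op : ℝ → ℝ → ℝ)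
    (hclosed : ∀ v ∈ Set.Ico 0 c, ∀ w ∈ Set.Ico 0 c, op v w ∈ Set.Ico 0 c)
    (hid : ∀ v ∈ Set.Ico 0 c, op 0 v = v ∧ op v 0 = v)
    (f : ℝ → ℝ)
    (hcont : ContinuousOn f (Set.Ico 0 c))
    (hanti : StrictAntiOn f (Set.Ico 0 c))
    (honto : f '' Set.Ico 0 c = Set.Ioc 0 1)
    (hfe : ∀ v ∈ Set.Ico 0 c, ∀ w ∈ Set.Ico 0 c, f (op v w) = f v * f w) :
    ∃ u : ℝ → ℝ, ∃ ξ : ℝ, 0 < ξ ∧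
      ContinuousOn u (Set.Ico 0 c) ∧ StrictMonoOn u (Set.Ico 0 c) ∧
      u '' Set.Ico 0 c = Set.Ico 0 c ∧
      ∀ v ∈ Set.Ico 0 c, f v = ((c - u v) / (c + u v)) ^ ξ := by
  have hmaps : Set.MapsTo f (Set.Ico 0 c) (Set.Ioc 0 1) := Set.mapsTo_iff_image_subset.2 honto.le
  refine ⟨fun v => c * (1 - f v) / (1 + f v), 1, one_pos, ?_,
    (strictAntiOn_mobius hc).comp hanti hmaps, ?_, fun v hv => ?_⟩
  · refine ContinuousOn.div (by fun_prop) (by fun_prop) fun v hv => ?_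
    linarith [(hmaps hv).1]
  · have himage := image_mobius_Ioc hc
    rwa [← honto, Set.image_image] at himage
  · have hpos : 1 + f v ≠ 0 := by linarith [(hmaps hv).1]
    have h1 : c - c * (1 - f v) / (1 + f v) = 2 * c * f v / (1 + f v) := by field_simp; ring
    have h2 : c + c * (1 - f v) / (1 + f v) = 2 * c / (1 + f v) := by field_simp; ring
    simp only [h1, h2, Real.rpow_one]
    field_simp
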